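/- arXiv:2005.10337 — 3 statements merged into one kernel-verified Lean document; each statement's English description precedes it below -/
import Mathlib

section
/- Let p ≥ 1 be an integer and let (ε_n)_{n∈ℤ} be a sequence of real numbers with L = sup_{n∈ℤ} |ε_n| < 1. For a = (a_k)_{k∈ℤ} ∈ ℓ²(ℤ) define H^p_ε(a)(n) = ∑_{k∈ℤ, k≠n} a_k / (n + ε_n − k)^p and H^p_0(a)(n) = ∑_{k∈ℤ, k≠n} a_k / (n − k)^p, both series converging absolutely for each n. Then ‖H^p_ε(a) − H^p_0(a)‖_{ℓ²(ℤ)} ≤ [ ((1+L)^p − 1)/(1−L)^p ]·2ζ(p+1)·‖a‖_{ℓ²(ℤ)} for all a ∈ ℓ²(ℤ). -/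
open Real

/-- The perturbed higher-order discrete Hilbert transform
`H^p_ε(a)(n) = ∑_{k ≠ n} a k / (n + ε_n - k)^p`. -/
noncomputable def HpertP (p : ℕ) (ε : ℤ → ℝ) (a : ℤ → ℂ) (n : ℤ) : ℂ :=
  ∑' k : ℤ, if k = n then 0
    else a k / (((n : ℝ) + ε n - (k : ℝ) : ℝ) : ℂ) ^ p

/-- `ζ(s) = ∑_{j ≥ 1} j^{-s}` as a real number (for natural `s`). -/
noncomputable def zetaReal (s : ℕ) : ℝ :=
  ∑' j : ℕ, 1 / ((j : ℝ) + 1) ^ s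

theorem sq_tsum_mul_le_tsum_mul_tsum {ι : Type*} {f g : ι → ℝ} (hf0 : ∀ i, 0 ≤ f i)
    (hf : Summable f) (hfg : Summable fun i => f i * g i ^ 2) :
    (Summable fun i => f i * g i) ∧
      (∑' i, f i * g i) ^ 2 ≤ (∑' i, f i) * ∑' i, f i * g i ^ 2 := by
  have hs : Summable fun i => f i * g i := by
    refine Summable.of_norm_bounded (hf.add hfg) fun i => ?_
    rw [Real.norm_eq_abs, abs_mul, abs_of_nonneg (hf0 i), ← sq_abs (g i)]
    nlinarith [mul_nonneg (hf0 i) (sq_nonneg (|g i| - 1)), hf0 i,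
      mul_nonneg (hf0 i) (sq_nonneg |g i|)]
  refine ⟨hs, ?_⟩
  have key : ∀ t : ℝ, 0 ≤ (∑' i, f i) * (t * t) + (-2 * ∑' i, f i * g i) * t
      + ∑' i, f i * g i ^ 2 := fun t => by
    have h : HasSum (fun i => f i * (t - g i) ^ 2) ((∑' i, f i) * (t * t)
        + (∑' i, f i * g i) * (-2 * t) + ∑' i, f i * g i ^ 2) := by
      have hexp : (fun i => f i * (t - g i) ^ 2) =
          fun i => f i * (t * t) + f i * g i * (-2 * t) + f i * g i ^ 2 := by
        funext i
        ring
      rw [hexp]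
      exact ((hf.hasSum.mul_right (t * t)).add (hs.hasSum.mul_right (-2 * t))).add hfg.hasSum
    have := h.nonneg fun i => mul_nonneg (hf0 i) (sq_nonneg _)
    linarith
  have := discrim_le_zero key
  rw [discrim] at this
  linarith

/-- Young's inequality `ℓ¹ * ℓ² ⊆ ℓ²` for convolutions on an additive commutative group. -/
theorem young_convolution_one_two {G : Type*} [AddCommGroup G] {K b : G → ℝ}
    (hK0 : ∀ m, 0 ≤ K m) (hK : Summable K) (hb : Summable fun k => b k ^ 2) :
    (∀ n, Summable fun k => K (n - k) * b k) ∧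
    (Summable fun n => (∑' k, K (n - k) * b k) ^ 2) ∧
      ∑' n, (∑' k, K (n - k) * b k) ^ 2 ≤ (∑' m, K m) ^ 2 * ∑' k, b k ^ 2 := by
  let e : G × G ≃ G × G :=
    { toFun := fun x => (x.1 - x.2, x.2)
      invFun := fun x => (x.1 + x.2, x.2)
      left_inv := fun x => by simp
      right_inv := fun x => by simp }
  have hprod : Summable fun x : G × G => K x.1 * b x.2 ^ 2 :=
    hK.mul_of_nonneg hb hK0 fun k => sq_nonneg _
  have hconv : Summable fun x : G × G => K (x.1 - x.2) * b x.2 ^ 2 :=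
    e.summable_iff.2 hprod
  have htot : ∑' n, ∑' k, K (n - k) * b k ^ 2 = (∑' m, K m) * ∑' k, b k ^ 2 := by
    rw [← hconv.tsum_prod, hK.tsum_mul_tsum hb hprod]
    exact e.tsum_eq fun x : G × G => K x.1 * b x.2 ^ 2
  have hcs := fun n => sq_tsum_mul_le_tsum_mul_tsum (f := fun k => K (n - k)) (g := b)
    (fun k => hK0 _) ((Equiv.subLeft n).summable_iff.2 hK) (hconv.prod_factor n)
  have hle : ∀ n, (∑' k, K (n - k) * b k) ^ 2 ≤ (∑' m, K m) * ∑' k, K (n - k) * b k ^ 2 :=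
    fun n => (hcs n).2.trans_eq (by rw [← (Equiv.subLeft n).tsum_eq K]; rfl)
  have hmaj : Summable fun n => (∑' m, K m) * ∑' k, K (n - k) * b k ^ 2 :=
    hconv.prod.mul_left _
  have hsum := Summable.of_nonneg_of_le (fun n => sq_nonneg _) hle hmaj
  refine ⟨fun n => (hcs n).1, hsum, (hsum.tsum_le_tsum hle hmaj).trans_eq ?_⟩
  rw [tsum_mul_left, htot]
  ring

theorem abs_mul_abs_add_pow_sub_pow_le {m e L : ℝ} (hm : 1 ≤ |m|) (he : |e| ≤ L) (p : ℕ) :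
    |m| * |(m + e) ^ p - m ^ p| ≤ |m| ^ p * ((1 + L) ^ p - 1) := by
  have hL : 0 ≤ L := (abs_nonneg e).trans he
  induction p with
  | zero => simp
  | succ p ih =>
    have hadd : |m + e| ≤ |m| * (1 + L) := by
      nlinarith [abs_add_le m e, mul_nonneg (sub_nonneg.2 hm) hL]
    calc |m| * |(m + e) ^ (p + 1) - m ^ (p + 1)|
        = |m| * |(m + e) * ((m + e) ^ p - m ^ p) + e * m ^ p| := by ring_nf
      _ ≤ |m| * (|m + e| * |(m + e) ^ p - m ^ p| + |e| * |m| ^ p) := by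
        gcongr
        refine (abs_add_le _ _).trans_eq ?_
        rw [abs_mul, abs_mul, abs_pow]
      _ = |m + e| * (|m| * |(m + e) ^ p - m ^ p|) + |e| * |m| ^ (p + 1) := by ring
      _ ≤ |m| * (1 + L) * (|m| ^ p * ((1 + L) ^ p - 1)) + L * |m| ^ (p + 1) := by gcongr
      _ = |m| ^ (p + 1) * ((1 + L) ^ (p + 1) - 1) := by ring

theorem one_sub_mul_abs_le_abs_add {m e L : ℝ} (hm : 1 ≤ |m|) (he : |e| ≤ L) :
    (1 - L) * |m| ≤ |m + e| := by
  have hL : 0 ≤ L := (abs_nonneg e).trans he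
  have h := abs_sub_abs_le_abs_sub m (-e)
  rw [abs_neg, sub_neg_eq_add] at h
  nlinarith [mul_nonneg (sub_nonneg.2 hm) hL]

theorem abs_one_div_add_pow_sub_le {m e L : ℝ} (hm : 1 ≤ |m|) (he : |e| ≤ L) (hL : L < 1)
    (p : ℕ) :
    |1 / (m + e) ^ p - 1 / m ^ p| ≤ ((1 + L) ^ p - 1) / (1 - L) ^ p * (1 / |m| ^ (p + 1)) := by
  have hL0 : 0 ≤ L := (abs_nonneg e).trans he
  have hmpos : 0 < |m| := by linarith
  have h1L : 0 < 1 - L := by linarith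
  have hlow := one_sub_mul_abs_le_abs_add hm he
  have hpos : 0 < |m + e| := (mul_pos h1L hmpos).trans_le hlow
  have hm0 : m ≠ 0 := abs_pos.1 hmpos
  have hme0 : m + e ≠ 0 := abs_pos.1 hpos
  have hc : 0 ≤ (1 + L) ^ p - 1 := sub_nonneg.2 (one_le_pow₀ (by linarith))
  calc |1 / (m + e) ^ p - 1 / m ^ p|
      = (|m| * |(m + e) ^ p - m ^ p|) / (|m| * |m| ^ p * |m + e| ^ p) := by
        rw [div_sub_div _ _ (pow_ne_zero _ hme0) (pow_ne_zero _ hm0), abs_div, abs_mul,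
          abs_pow, abs_pow, one_mul, mul_one, abs_sub_comm]
        field_simp
    _ ≤ (|m| ^ p * ((1 + L) ^ p - 1)) / (|m| * |m| ^ p * ((1 - L) * |m|) ^ p) := by
        gcongr ?_ / (_ * ?_ ^ p)
        exact abs_mul_abs_add_pow_sub_pow_le hm he p
    _ = ((1 + L) ^ p - 1) / (1 - L) ^ p * (1 / |m| ^ (p + 1)) := by
        rw [mul_pow]
        field_simp
        ring

theorem summable_one_div_abs_int_pow {s : ℕ} (hs : 1 < s) :
    Summable fun m : ℤ => 1 / |(m : ℝ)| ^ s := by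
  simpa [abs_pow] using (Real.summable_one_div_int_pow.2 hs).abs

theorem tsum_one_div_abs_int_pow {s : ℕ} (hs : 1 < s) :
    ∑' m : ℤ, 1 / |(m : ℝ)| ^ s = 2 * zetaReal s := by
  have habs : ∀ j : ℕ, |(j : ℝ) + 1| = (j : ℝ) + 1 := fun j => abs_of_nonneg (by positivity)
  have hnat : Summable fun j : ℕ => 1 / ((j : ℝ) + 1) ^ s := by
    simpa using (summable_nat_add_iff 1).2 (Real.summable_one_div_nat_pow.2 hs)
  have hpos : HasSum (fun j : ℕ => 1 / |(((j : ℤ) + 1 : ℤ) : ℝ)| ^ s) (zetaReal s) := by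
    push_cast
    simp_rw [habs]
    exact hnat.hasSum
  have hneg : HasSum (fun j : ℕ => 1 / |((-((j : ℤ) + 1) : ℤ) : ℝ)| ^ s) (zetaReal s) := by
    push_cast
    simp_rw [abs_neg, habs]
    exact hnat.hasSum
  rw [(HasSum.of_add_one_of_neg_add_one (f := fun m : ℤ => 1 / |(m : ℝ)| ^ s) hpos hneg).tsum_eq]
  have : s ≠ 0 := by omega
  simp [this]
  ring

theorem one_le_abs_int_sub {n k : ℤ} (h : k ≠ n) : 1 ≤ |(n : ℝ) - k| := by
  exact_mod_cast Int.one_le_abs (sub_ne_zero.2 h.symm)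

theorem summable_norm_HpertP_term {p : ℕ} (hp : 1 ≤ p) {L e : ℝ} (he : |e| ≤ L) (hL : L < 1)
    {a : ℤ → ℂ} (ha : Summable fun k : ℤ => ‖a k‖ ^ 2) (n : ℤ) :
    Summable fun k : ℤ =>
      ‖(if k = n then 0 else a k / (((n : ℝ) + e - (k : ℝ) : ℝ) : ℂ) ^ p)‖ := by
  have h1L : 0 < 1 - L := by linarith
  have hK : Summable fun k : ℤ => 1 / |(((n - k : ℤ)) : ℝ)| ^ (2 * p) := by
    have hs : 1 < 2 * p := by omega
    exact (summable_one_div_abs_int_pow hs).comp_injective (Equiv.subLeft n).injective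
  refine Summable.of_nonneg_of_le (fun k => norm_nonneg _) (fun k => ?_)
    (ha.add (hK.mul_left (1 / (1 - L) ^ (2 * p))))
  split_ifs with h
  · rw [norm_zero]
    positivity
  have hm := one_le_abs_int_sub h
  have hlow := one_sub_mul_abs_le_abs_add hm he
  have hmL : 0 < (1 - L) * |(n : ℝ) - k| := mul_pos h1L (by linarith)
  have hx : 1 / |(n : ℝ) - k + e| ^ p ≤ 1 / ((1 - L) * |(n : ℝ) - k|) ^ p := by gcongr
  have hy : 1 / (1 - L) ^ (2 * p) * (1 / |(((n - k : ℤ)) : ℝ)| ^ (2 * p))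
      = (1 / ((1 - L) * |(n : ℝ) - k|) ^ p) ^ 2 := by
    push_cast
    rw [div_pow, one_pow, ← pow_mul, mul_comm p 2, mul_pow]
    field_simp
  rw [hy, norm_div, norm_pow, Complex.norm_real, Real.norm_eq_abs, add_sub_right_comm,
    div_eq_mul_one_div]
  have hx0 : 0 ≤ 1 / |(n : ℝ) - k + e| ^ p := by positivity
  refine (mul_le_mul_of_nonneg_left hx (norm_nonneg (a k))).trans ?_
  refine le_trans ?_ (two_mul_le_add_sq ‖a k‖ _)
  have := mul_nonneg (norm_nonneg (a k)) (hx0.trans hx)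
  linarith

theorem norm_HpertP_term_sub_le {L e : ℝ} (he : |e| ≤ L) (hL : L < 1) (p : ℕ) (a : ℤ → ℂ)
    (n k : ℤ) :
    ‖(if k = n then 0 else a k / (((n : ℝ) + e - (k : ℝ) : ℝ) : ℂ) ^ p) -
        (if k = n then 0 else a k / (((n : ℝ) + 0 - (k : ℝ) : ℝ) : ℂ) ^ p)‖ ≤
      ((1 + L) ^ p - 1) / (1 - L) ^ p * (1 / |((n - k : ℤ) : ℝ)| ^ (p + 1)) * ‖a k‖ := by
  split_ifs with h
  · simp [h]
  have := abs_one_div_add_pow_sub_le (one_le_abs_int_sub h) he hL p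
  rw [add_zero, add_sub_right_comm, div_eq_mul_one_div, div_eq_mul_one_div (a k), ← mul_sub,
    norm_mul, mul_comm]
  push_cast at this ⊢
  gcongr
  refine le_trans (le_of_eq ?_) this
  rw [← Real.norm_eq_abs, ← Complex.norm_real]
  push_cast
  rfl

theorem stmt14 (p : ℕ) (hp : 1 ≤ p) (ε : ℤ → ℝ) (L : ℝ)
    (hLbd : ∀ n : ℤ, |ε n| ≤ L) (hL : L < 1)
    (a : ℤ → ℂ) (ha : Summable fun k : ℤ => ‖a k‖ ^ 2) :
    -- both defining series converge absolutely for each `n`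
    (∀ n : ℤ, Summable fun k : ℤ =>
      ‖(if k = n then 0 else a k / (((n : ℝ) + ε n - (k : ℝ) : ℝ) : ℂ) ^ p)‖) ∧
    (∀ n : ℤ, Summable fun k : ℤ =>
      ‖(if k = n then 0 else a k / (((n : ℝ) - (k : ℝ) : ℝ) : ℂ) ^ p)‖) ∧
    -- the ℓ² bound on the difference `H^p_ε - H^p_0`
    Summable (fun n : ℤ => ‖HpertP p ε a n - HpertP p (fun _ => 0) a n‖ ^ 2) ∧
    Real.sqrt (∑' n : ℤ, ‖HpertP p ε a n - HpertP p (fun _ => 0) a n‖ ^ 2) ≤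
      (((1 + L) ^ p - 1) / (1 - L) ^ p) * (2 * zetaReal (p + 1)) *
        Real.sqrt (∑' k : ℤ, ‖a k‖ ^ 2) := by
  have hL0 : 0 ≤ L := (abs_nonneg _).trans (hLbd 0)
  have hsε := fun n => summable_norm_HpertP_term hp (hLbd n) hL ha n
  have hs0 := fun n => summable_norm_HpertP_term hp (abs_zero.trans_le hL0) hL ha n
  have hc : 0 ≤ ((1 + L) ^ p - 1) / (1 - L) ^ p :=
    div_nonneg (sub_nonneg.2 (one_le_pow₀ (by linarith))) (pow_nonneg (by linarith) _)
  set c := ((1 + L) ^ p - 1) / (1 - L) ^ p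
  obtain ⟨hconv, hsum, hle⟩ := young_convolution_one_two
    (K := fun m : ℤ => c * (1 / |(m : ℝ)| ^ (p + 1))) (b := fun k => ‖a k‖)
    (fun m => by positivity)
    ((summable_one_div_abs_int_pow (by omega : 1 < p + 1)).mul_left c) ha
  rw [tsum_mul_left, tsum_one_div_abs_int_pow (by omega : 1 < p + 1)] at hle
  have hpt : ∀ n, ‖HpertP p ε a n - HpertP p (fun _ => 0) a n‖ ^ 2 ≤
      (∑' k, c * (1 / |((n - k : ℤ) : ℝ)| ^ (p + 1)) * ‖a k‖) ^ 2 := fun n => by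
    gcongr
    rw [HpertP, HpertP, ← (hsε n).of_norm.tsum_sub (hs0 n).of_norm]
    exact tsum_of_norm_bounded (hconv n).hasSum
      fun k => norm_HpertP_term_sub_le (hLbd n) hL p a n k
  have hdiff := Summable.of_nonneg_of_le (fun n => sq_nonneg _) hpt hsum
  have hz : 0 ≤ zetaReal (p + 1) := tsum_nonneg fun j => by positivity
  refine ⟨hsε, by simpa only [add_zero] using hs0, hdiff, ?_⟩
  rw [← Real.sqrt_sq (show 0 ≤ c * (2 * zetaReal (p + 1)) by positivity),
    ← Real.sqrt_mul (sq_nonneg _)]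
  exact Real.sqrt_le_sqrt ((hdiff.tsum_le_tsum hpt hsum).trans hle)
end

section
/- Let α ∈ (0, 1/2) and c ∈ (0, 1], and let n be a positive integer such that (n/c²)^{1/(2α)} ≥ 2. Set m = ⌊(n/c²)^{1/(2α)}⌋. Then |√n − c·m^α| ≤ 2·α·c^{1/α}·n^{(α−1)/(2α)}. -/
open Real

theorem abs_rpow_sub_floor_rpow_le {α x : ℝ} (hα₀ : 0 ≤ α) (hα₁ : α ≤ 1) (hx : 1 ≤ x) :
    |x ^ α - (⌊x⌋ : ℝ) ^ α| ≤ 2 * α * x ^ (α - 1) := by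
  have hfloor : (1 : ℝ) ≤ ⌊x⌋ := by exact_mod_cast Int.le_floor.2 (by simpa using hx)
  have hle : (⌊x⌋ : ℝ) ≤ x := Int.floor_le x
  have hlt : x < ⌊x⌋ + 1 := Int.lt_floor_add_one x
  set k : ℝ := (⌊x⌋ : ℝ)
  have hk : 0 < k := by linarith
  have hx₀ : 0 < x := by linarith
  have hmono : k ^ α ≤ x ^ α := rpow_le_rpow hk.le hle hα₀
  have hs : 0 ≤ (x - k) / k := div_nonneg (by linarith) hk.le
  have hbernoulli : (1 + (x - k) / k) ^ α ≤ 1 + α * ((x - k) / k) :=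
    rpow_one_add_le_one_add_mul_self (by linarith) hα₀ hα₁
  have hfactor : x ^ α = k ^ α * (1 + (x - k) / k) ^ α := by
    rw [← mul_rpow hk.le (by linarith)]
    congr 1
    field_simp
    ring
  have hratio : (x - k) / k ≤ 2 / x := by
    rw [div_le_div_iff₀ hk hx₀]
    nlinarith
  rw [abs_of_nonneg (sub_nonneg.2 hmono)]
  calc x ^ α - k ^ α ≤ k ^ α * (α * ((x - k) / k)) := by
        have := mul_le_mul_of_nonneg_left hbernoulli (rpow_nonneg hk.le α)
        linarith
    _ ≤ x ^ α * (α * (2 / x)) := by gcongr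
    _ = 2 * α * x ^ (α - 1) := by
        rw [rpow_sub_one hx₀.ne']
        ring

theorem stmt17 (α c : ℝ) (hα : α ∈ Set.Ioo (0 : ℝ) (1/2)) (hc : c ∈ Set.Ioc (0 : ℝ) 1)
    (n : ℕ) (hn : 0 < n) (h2 : (2 : ℝ) ≤ ((n : ℝ) / c ^ 2) ^ (1 / (2 * α)))
    (m : ℤ) (hm : m = ⌊((n : ℝ) / c ^ 2) ^ (1 / (2 * α))⌋) :
    |Real.sqrt n - c * (m : ℝ) ^ α| ≤
      2 * α * c ^ (1 / α) * (n : ℝ) ^ ((α - 1) / (2 * α)) := by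
  obtain ⟨hα₀, hα₁⟩ := hα
  have hc₀ : 0 < c := hc.1
  have hn₀ : (0 : ℝ) < n := by exact_mod_cast hn
  have hbase : (0 : ℝ) ≤ n / c ^ 2 := by positivity
  have hpow (s : ℝ) : (((n : ℝ) / c ^ 2) ^ (1 / (2 * α))) ^ s =
      (n : ℝ) ^ (s / (2 * α)) * c ^ (-(s / α)) := by
    rw [← rpow_mul hbase, div_rpow hn₀.le (by positivity), ← rpow_natCast c 2,
      ← rpow_mul hc₀.le, div_eq_mul_inv, ← rpow_neg hc₀.le]
    congr 2 <;> push_cast <;> field_simp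
  have hsqrt : √(n : ℝ) = c * (((n : ℝ) / c ^ 2) ^ (1 / (2 * α))) ^ α := by
    rw [hpow, sqrt_eq_rpow, div_self hα₀.ne', rpow_neg_one,
      show α / (2 * α) = 1 / 2 by field_simp]
    field_simp
  have hcpow : c * c ^ (-((α - 1) / α)) = c ^ (1 / α) := by
    rw [← rpow_one_add' hc₀.le]
    · congr 1
      field_simp
      ring
    · rw [show 1 + -((α - 1) / α) = 1 / α by field_simp; ring]
      positivity
  rw [hsqrt, ← mul_sub, abs_mul, abs_of_pos hc₀, hm]
  calc _ ≤ c * (2 * α * (((n : ℝ) / c ^ 2) ^ (1 / (2 * α))) ^ (α - 1)) := by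
        gcongr
        exact abs_rpow_sub_floor_rpow_le hα₀.le (by linarith) (by linarith)
    _ = _ := by
        rw [hpow, ← hcpow]
        ring
end

section
/- For every real number L with 0 < L ≤ 0.239, the inequality (1 − sin(πL)/(πL)) + sin(πL) + (π/3)·L·sin(πL)/(1−L) < 1 holds. -/
open Real

theorem stmt18 (L : ℝ) (h0 : 0 < L) (h1 : L ≤ 0.239) :
    (1 - Real.sin (π * L) / (π * L)) + Real.sin (π * L)
      + (π / 3) * (L * Real.sin (π * L) / (1 - L)) < 1 := by
  have hπ : π < 3.1416 := pi_lt_d4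
  have hx0 : 0 < π * L := mul_pos pi_pos h0
  have hL : 0 < 1 - L := by linarith
  have hx : π * L ≤ 0.75085 := by
    have : π * L ≤ 3.1416 * 0.239 := by gcongr
    linarith
  have hs : 0 < sin (π * L) := sin_pos_of_pos_of_lt_pi hx0 (by linarith [pi_gt_three])
  have key : (π * L) ^ 2 < (1 - π * L) * (3 * (1 - L)) := by
    have h2 : (π * L) ^ 2 ≤ 0.75085 ^ 2 := by gcongr
    have h3 : (0.24915 : ℝ) * (3 * 0.761) ≤ (1 - π * L) * (3 * (1 - L)) := by
      apply mul_le_mul <;> linarith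
    linarith
  have hfactor : (1 - sin (π * L) / (π * L)) + sin (π * L)
      + (π / 3) * (L * sin (π * L) / (1 - L))
      = 1 - sin (π * L) * ((1 - π * L) * (3 * (1 - L)) - (π * L) ^ 2)
        / (π * L * (3 * (1 - L))) := by
    have := pi_ne_zero
    field_simp
    ring
  rw [hfactor]
  exact sub_lt_self _ (div_pos (mul_pos hs (sub_pos.2 key)) (by positivity))
end
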